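/- Every nonempty finite set T of ground terms over a first-order language L has a least general generalization: there exists a term u (with variables) such that every t ∈ T is a substitution instance of u, and every term u′ of which all elements of T are substitution instances also has u as a substitution instance. (This is the declarative content of the generalized Δ-vector Δ_G, which computes a simple decomposition {u} ∘ W of T.) -/

import Mathlib

open FirstOrder FirstOrder.Language

/-- A term `u` (with variables drawn from `ℕ`) *generalizes* a ground term `t` if
`t = uσ` for some substitution `σ` assigning ground terms to the variables. -/
def Generalizes {L : Language} (u : L.Term ℕ) (t : L.Term Empty) : Prop :=
  ∃ σ : ℕ → L.Term Empty, u.subst σ = t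

/-- `u` is a least general generalization of the set `T` of ground terms: it
generalizes every element of `T`, and every term `u'` that generalizes all elements
of `T` also generalizes `u` (i.e. `u` is a substitution instance of `u'`). -/
def IsLGG {L : Language} (u : L.Term ℕ) (T : Finset (L.Term Empty)) : Prop :=
  (∀ t ∈ T, Generalizes u t) ∧
  ∀ u' : L.Term ℕ, (∀ t ∈ T, Generalizes u' t) → ∃ σ : ℕ → L.Term ℕ, u'.subst σ = u

/-- Anti-unification of a vector `v` of ground terms, by recursion on a guide term;
the variables are the vectors of ground terms themselves. -/
noncomputable def auxDelta {L : Language} {I : Type*} :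
    L.Term Empty → (I → L.Term Empty) → L.Term (I → L.Term Empty)
  | .var a, _ => a.elim
  | @Term.func _ _ l f ts, v =>
    open Classical in
    if h : ∃ w : Fin l → I → L.Term Empty, ∀ i, v i = Term.func f (fun k => w k i) then
      Term.func f (fun k => auxDelta (ts k) (h.choose k))
    else Term.var v

theorem auxDelta_func {L : Language} {I : Type*} {l : ℕ} (f : L.Functions l)
    (ts : Fin l → L.Term Empty) (w : Fin l → I → L.Term Empty) :
    auxDelta (Term.func f ts) (fun i => Term.func f (fun k => w k i)) =
      Term.func f (fun k => auxDelta (ts k) (w k)) := by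
  have h : ∃ w' : Fin l → I → L.Term Empty, ∀ i,
      (fun i => Term.func f (fun k => w k i)) i = Term.func f (fun k => w' k i) :=
    ⟨w, fun _ => rfl⟩
  have hw : h.choose = w := by
    funext k i
    have h1 := h.choose_spec i
    simp only [Term.func.injEq, heq_eq_eq, true_and] at h1
    exact (congrFun h1 k).symm
  rw [auxDelta, dif_pos h, hw]

theorem auxDelta_subst {L : Language} {I : Type*} (i : I) (t : L.Term Empty) :
    ∀ v : I → L.Term Empty, (auxDelta t v).subst (fun w => w i) = v i := by
  induction t with
  | var a => exact a.elim
  | func f ts ih =>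
    intro v
    rw [auxDelta]
    split_ifs with h
    · rw [h.choose_spec i]
      simp only [Term.subst, ih]
    · rfl

theorem subst_auxDelta {L : Language} {I : Type*} (i : I) (σ : I → ℕ → L.Term Empty)
    (u : L.Term ℕ) :
    u.subst (fun x => auxDelta (σ i x) (fun j => σ j x)) =
      auxDelta (u.subst (σ i)) (fun j => u.subst (σ j)) := by
  induction u with
  | var a => rfl
  | func f ts ih =>
    simp only [Term.subst, ih]
    exact (auxDelta_func f _ (fun k j => (ts k).subst (σ j))).symm

theorem relabel_subst_aux {L : Language} {α β γ : Type*} (g : β → γ) (σ : α → L.Term β)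
    (u : L.Term α) : (u.subst σ).relabel g = u.subst (fun x => (σ x).relabel g) := by
  induction u with
  | var a => rfl
  | func f ts ih => simp only [Term.subst, Term.relabel, ih]

theorem subst_relabel_aux {L : Language} {α β γ : Type*} [DecidableEq α] (g : α → β)
    (σ : β → L.Term γ) (τ : α → L.Term γ) (u : L.Term α)
    (h : ∀ x ∈ u.varFinset, σ (g x) = τ x) : (u.relabel g).subst σ = u.subst τ := by
  induction u with
  | var a => exact h a (by simp)
  | func f ts ih =>
    simp only [Term.subst, Term.relabel, Term.func.injEq, heq_eq_eq, true_and]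
    funext k
    exact ih k fun x hx => h x (by simpa using ⟨k, hx⟩)

/-- Every nonempty finite set `T` of ground terms over a
first-order language `L` has a least general generalization. -/
theorem exists_lgg {L : Language} (T : Finset (L.Term Empty)) (hT : T.Nonempty) :
    ∃ u : L.Term ℕ, IsLGG u T := by
  classical
  obtain ⟨t0, ht0⟩ := hT
  let i0 : T := ⟨t0, ht0⟩
  let v : T → L.Term Empty := fun i => i.1
  let U := auxDelta (v i0) v
  obtain ⟨g, hg⟩ : ∃ g : (T → L.Term Empty) → ℕ, Set.InjOn g U.varFinset :=
    Set.countable_iff_exists_injOn.1 U.varFinset.finite_toSet.countable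
  refine ⟨U.relabel g, fun t ht => ?_, fun u' hu' => ?_⟩
  · have : Nonempty (T → L.Term Empty) := ⟨v⟩
    refine ⟨fun n => Function.invFunOn g U.varFinset n ⟨t, ht⟩, ?_⟩
    rw [subst_relabel_aux g _ (fun w => w ⟨t, ht⟩)]
    · exact auxDelta_subst (⟨t, ht⟩ : T) (v i0) v
    · intro x hx
      exact congrFun (hg.leftInvOn_invFunOn (Finset.mem_coe.2 hx)) _
  · choose σ hσ using fun i : T => hu' i.1 i.2
    refine ⟨fun x => (auxDelta (σ i0 x) (fun j => σ j x)).relabel g, ?_⟩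
    rw [← relabel_subst_aux, subst_auxDelta]
    simp only [hσ]
    rfl
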